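/- For any flat formula φ of BID-logic, (φ → ⊥) → ⊥ is logically equivalent to φ: for every model M and team X, M ⊨_X (φ→⊥)→⊥ iff M ⊨_X φ (double intuitionistic negation elimination holds for flat formulas). -/

import Mathlib

/-- Double intuitionistic negation elimination for flat formulas:
if `Sat` is the satisfaction relation of a flat formula `φ`
(`M ⊨_X φ` iff `M ⊨_{s} φ` for every `s ∈ X`), then for every team `X`,
`M ⊨_X (φ → ⊥) → ⊥` iff `M ⊨_X φ`. -/
theorem double_neg_flat {V M : Type*} (Sat : Set (V → M) → Prop)
    (hflat : ∀ X : Set (V → M), Sat X ↔ ∀ s ∈ X, Sat {s})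
    (X : Set (V → M)) :
    (∀ Y ⊆ X, (∀ Z ⊆ Y, Sat Z → Z = ∅) → Y = ∅) ↔ Sat X := by
  rw [hflat X]
  constructor
  · intro h s hs
    by_contra hns
    refine Set.singleton_ne_empty s (h {s} (Set.singleton_subset_iff.2 hs) fun Z hZ hSat => ?_)
    rcases Set.subset_singleton_iff_eq.1 hZ with rfl | rfl
    · rfl
    · exact absurd hSat hns
  · intro h Y hY hneg
    refine Set.eq_empty_of_forall_notMem fun s hs => ?_
    exact Set.singleton_ne_empty s (hneg {s} (Set.singleton_subset_iff.2 hs) (h s (hY hs)))
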